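/- Let r be a prime power and let U be a subunital of order q (q ≥ 2 an integer) of the hermitian unital H(GF(r²)|GF(r)). Then q is a prime power, there exists an odd positive integer e with r = q^e, and the embedding is standard: GF(q²) is a subfield of GF(r²) with GF(q²) ∩ GF(r) = GF(q), and there exist ε' ∈ GF(q²) \ GF(q) and an invertible 3×3 matrix g over GF(r²) such that U = { [g·(x,y,z)ᵀ] ∈ PG(2,GF(r²)) : (x,y,z) ∈ GF(q²)³ \ {0} with x^q·y + z^{q+1} ∈ ε'·GF(q) }. -/

import Mathlib

noncomputable section

/-- A line of the projective plane `PG(2,K)`: the zero set of a nonzero linear form. -/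
def IsLine (K : Type*) [Field K] (ℓ : Set (Projectivization K (Fin 3 → K))) : Prop :=
  ∃ f : (Fin 3 → K) →ₗ[K] K, f ≠ 0 ∧ ℓ = {P : Projectivization K (Fin 3 → K) | f P.rep = 0}

/-- The point set of the hermitian unital over a finite field, where the Galois
involution is `x ↦ x ^ s`: points `[X,Y,Z]` with `X^s·Y + Z^(s+1) ∈ ε'·F`. -/
def hermSetPow {K : Type*} [Field K] (F : Subfield K) (s : ℕ) (ε' : K) :
    Set (Projectivization K (Fin 3 → K)) :=
  {P | ∃ v : Fin 3 → K, ∃ hv : v ≠ 0, P = Projectivization.mk K v hv ∧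
        ∃ f ∈ F, v 0 ^ s * v 1 + v 2 ^ (s + 1) = ε' * f}

/-- A block of the finite hermitian unital: the trace of a line meeting the point
set in at least two points. -/
def IsHermBlockPow {K : Type*} [Field K] (F : Subfield K) (s : ℕ) (ε' : K)
    (B : Set (Projectivization K (Fin 3 → K))) : Prop :=
  ∃ ℓ, IsLine K ℓ ∧ (hermSetPow F s ε' ∩ ℓ).Nontrivial ∧ B = hermSetPow F s ε' ∩ ℓ

/-- The affine part of a subunital containing the point at infinity of the vertical lines, in
the affine unital `{(z, η) | η + δ * (z * σ z) is fixed by σ}`. -/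
structure IsAffineSubunital {K : Type*} [Field K] (σ : K →+* K) (δ : K) (q : ℕ)
    (D : Set (K × K)) : Prop where
  real : ∀ z η, (z, η) ∈ D → σ (η + δ * (z * σ z)) = η + δ * (z * σ z)
  card : D.ncard = q ^ 3
  fiber : ∀ z η, (z, η) ∈ D → {ξ | (z, ξ) ∈ D}.ncard = q
  line : ∀ m n, {z | (z, m * z + n) ∈ D}.Nontrivial → {z | (z, m * z + n) ∈ D}.ncard = q + 1

/-- Two circles `m * z + n + δ * (z * σ z) = σ _` sharing three points have the same slope. -/
lemma slope_eq_zero_of_three_points {K : Type*} [Field K] {σ : K →+* K}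
    (hσ : ∀ x, σ (σ x) = x) {δ : K} (hδ : σ δ ≠ δ) {m n μ ν z₁ z₂ z₃ : K}
    (h₁₂ : z₁ ≠ z₂) (h₁₃ : z₁ ≠ z₃) (h₂₃ : z₂ ≠ z₃)
    (h : ∀ z ∈ ({z₁, z₂, z₃} : Set K),
      σ (m * z + n + δ * (z * σ z)) = m * z + n + δ * (z * σ z) ∧ σ (μ * z + ν) = μ * z + ν) :
    μ = 0 := by
  by_contra hμ
  obtain ⟨c₁, l₁⟩ := h z₁ (by simp)
  obtain ⟨c₂, l₂⟩ := h z₂ (by simp)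
  obtain ⟨c₃, l₃⟩ := h z₃ (by simp)
  obtain ⟨k, hk⟩ : ∃ k, k * μ = 1 := ⟨μ⁻¹, inv_mul_cancel₀ hμ⟩
  obtain ⟨a, ha⟩ : ∃ a, a = μ * (z₂ - z₁) := ⟨_, rfl⟩
  obtain ⟨b, hb⟩ : ∃ b, b = μ * (z₃ - z₁) := ⟨_, rfl⟩
  have ha0 : a ≠ 0 := by rw [ha]; exact mul_ne_zero hμ (sub_ne_zero.2 h₁₂.symm)
  have hb0 : b ≠ 0 := by rw [hb]; exact mul_ne_zero hμ (sub_ne_zero.2 h₁₃.symm)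
  have hab : a - b ≠ 0 := by
    have : a - b = μ * (z₂ - z₃) := by rw [ha, hb]; ring
    rw [this]; exact mul_ne_zero hμ (sub_ne_zero.2 h₂₃)
  have hk0 : k ≠ 0 := left_ne_zero_of_mul_eq_one hk
  have hz₂ : z₂ = z₁ + a * k := by rw [ha]; linear_combination (-(z₂ - z₁)) * hk
  have hz₃ : z₃ = z₁ + b * k := by rw [hb]; linear_combination (-(z₃ - z₁)) * hk
  simp only [map_add, map_mul] at l₁ l₂ l₃
  have ra : σ a = a := by
    rw [ha]; simp only [map_mul, map_sub]; linear_combination l₂ - l₁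
  have rb : σ b = b := by
    rw [hb]; simp only [map_mul, map_sub]; linear_combination l₃ - l₁
  rw [hz₂] at c₂
  rw [hz₃] at c₃
  simp only [map_add, map_mul, hσ, ra, rb] at c₁ c₂ c₃
  have e : (a * b * (a - b)) * ((σ δ - δ) * (k * σ k)) = 0 := by
    linear_combination b * (c₂ - c₁) - a * (c₃ - c₁)
  have : σ k ≠ 0 := (map_ne_zero σ).2 hk0
  exact mul_ne_zero (mul_ne_zero (mul_ne_zero ha0 hb0) hab)
    (mul_ne_zero (sub_ne_zero.2 hδ) (mul_ne_zero hk0 this)) e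

namespace IsAffineSubunital

variable {K : Type*} [Field K] [Finite K] {σ : K →+* K} {δ : K} {q : ℕ} {D : Set (K × K)}

lemma ncard_image_fst (hD : IsAffineSubunital σ δ q D) (hq : 2 ≤ q) :
    (Prod.fst '' D).ncard = q ^ 2 := by
  classical
  have := Fintype.ofFinite K
  have h := Finset.card_eq_sum_card_image (Prod.fst) D.toFinset
  have h2 : ∀ z ∈ D.toFinset.image Prod.fst,
      (D.toFinset.filter fun p => p.1 = z).card = q := by
    intro z hz
    obtain ⟨p, hp, rfl⟩ := Finset.mem_image.1 hz
    rw [← hD.fiber p.1 p.2 (by simpa using hp), ← Set.ncard_coe_finset]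
    symm
    apply Set.ncard_congr (fun ξ _ => (p.1, ξ))
    · intro a ha; simpa using ha
    · intro a b _ _ h; simpa using h
    · rintro ⟨x, y⟩ hb
      obtain ⟨h1, rfl⟩ := by simpa using hb
      exact ⟨y, h1, rfl⟩
  rw [Finset.sum_congr rfl h2, Finset.sum_const, smul_eq_mul, ← Set.ncard_eq_toFinset_card',
    hD.card] at h
  have h3 : (Prod.fst '' D).ncard = (D.toFinset.image Prod.fst).card := by
    rw [← Set.ncard_coe_finset]; simp
  rw [h3]
  have : 0 < q := by omega
  apply Nat.eq_of_mul_eq_mul_right this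
  rw [← h]; ring

/-- Only `q` slopes occur among the secants joining two given vertical lines. -/
lemma ncard_slopes_le (hD : IsAffineSubunital σ δ q D) (hq : 2 ≤ q)
    (hσ : ∀ x, σ (σ x) = x) (hδ : σ δ ≠ δ) {z₁ z₂ : K} (hz : z₁ ≠ z₂) :
    {m | ∃ η, (z₁, η) ∈ D ∧ (z₂, η + m * (z₂ - z₁)) ∈ D}.ncard ≤ q := by
  classical
  have := Fintype.ofFinite K
  set M := {m | ∃ η, (z₁, η) ∈ D ∧ (z₂, η + m * (z₂ - z₁)) ∈ D} with hM
  rcases M.eq_empty_or_nonempty with h0 | ⟨m₀, η₀, h₁, h₂⟩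
  · simp [h0]
  let T : K → Finset K := fun m =>
    {z | z ≠ z₁ ∧ z ≠ z₂ ∧ ∃ η, (z₁, η) ∈ D ∧ (z₂, η + m * (z₂ - z₁)) ∈ D ∧
      (z, η + m * (z - z₁)) ∈ D}
  have hcard : ∀ m ∈ M.toFinset, q - 1 ≤ (T m).card := by
    intro m hm
    obtain ⟨η, a, b⟩ := Set.mem_toFinset.1 hm
    have e : ∀ z, m * z + (η - m * z₁) = η + m * (z - z₁) := fun z => by ring
    have hl := hD.line m (η - m * z₁) ⟨z₁, by simpa [e] using a, z₂, by simpa [e] using b, hz⟩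
    simp only [e] at hl
    have : {z | (z, η + m * (z - z₁)) ∈ D} ⊆ ↑(insert z₁ (insert z₂ (T m))) := by
      intro z hz
      simp only [T, Finset.coe_insert, Finset.coe_filter, Finset.mem_univ, true_and,
        Set.mem_insert_iff, Set.mem_ofPred_eq]
      by_cases h1 : z = z₁
      · exact .inl h1
      by_cases h2 : z = z₂
      · exact .inr (.inl h2)
      exact .inr (.inr ⟨h1, h2, η, a, b, hz⟩)
    have h3 := Set.ncard_le_ncard this (Set.toFinite _)
    rw [hl, Set.ncard_coe_finset] at h3
    have := Finset.card_insert_le z₁ (insert z₂ (T m))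
    have := Finset.card_insert_le z₂ (T m)
    omega
  have hdisj : (M.toFinset : Set K).PairwiseDisjoint T := by
    intro m _ m' _ hmm
    refine Finset.disjoint_left.2 fun z hz1 hz2 => hmm ?_
    simp only [T, Finset.mem_filter, Finset.mem_univ, true_and] at hz1 hz2
    obtain ⟨n1, n2, η, a, b, c⟩ := hz1
    obtain ⟨-, -, η', a', b', c'⟩ := hz2
    refine sub_eq_zero.1 (slope_eq_zero_of_three_points hσ hδ (m := m) (n := η - m * z₁)
      (ν := (η - m * z₁) - (η' - m' * z₁)) hz n1.symm n2.symm ?_)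
    have key : ∀ w, (w, η + m * (w - z₁)) ∈ D → (w, η' + m' * (w - z₁)) ∈ D →
        σ (m * w + (η - m * z₁) + δ * (w * σ w)) = m * w + (η - m * z₁) + δ * (w * σ w) ∧
        σ ((m - m') * w + (η - m * z₁ - (η' - m' * z₁))) =
          (m - m') * w + (η - m * z₁ - (η' - m' * z₁)) := by
      intro w h h'
      have r := hD.real _ _ h
      have r' := hD.real _ _ h'
      have e : m * w + (η - m * z₁) + δ * (w * σ w) = η + m * (w - z₁) + δ * (w * σ w) := by ring
      have e' : (m - m') * w + (η - m * z₁ - (η' - m' * z₁)) = (η + m * (w - z₁) + δ * (w * σ w))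
        - (η' + m' * (w - z₁) + δ * (w * σ w)) := by ring
      rw [e, e', map_sub, r, r']
      exact ⟨rfl, rfl⟩
    intro w hw
    rcases hw with rfl | rfl | rfl
    · exact key _ (by simpa using a) (by simpa using a')
    · exact key _ b b'
    · exact key _ c c'
  have hsub : insert z₁ (insert z₂ (M.toFinset.biUnion T)) ⊆ (Prod.fst '' D).toFinset := by
    intro z
    simp only [Finset.mem_insert, Finset.mem_biUnion, Set.mem_toFinset, Set.mem_image, T,
      Finset.mem_filter, Finset.mem_univ, true_and]
    rintro (rfl | rfl | ⟨m, -, -, -, η, -, -, c⟩)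
    · exact ⟨_, h₁, rfl⟩
    · exact ⟨_, h₂, rfl⟩
    · exact ⟨_, c, rfl⟩
  have h5 := Finset.card_le_card hsub
  rw [← Set.ncard_eq_toFinset_card', hD.ncard_image_fst hq, Finset.card_insert_of_notMem,
    Finset.card_insert_of_notMem, Finset.card_biUnion hdisj] at h5
  · have h6 := Finset.card_nsmul_le_sum _ _ _ hcard
    rw [← Set.ncard_eq_toFinset_card', smul_eq_mul] at h6
    by_contra! hlt
    obtain ⟨k, rfl⟩ : ∃ k, q = k + 1 := ⟨q - 1, by omega⟩
    simp only [Nat.add_sub_cancel] at h6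
    have : (k + 2) * k ≤ M.ncard * k := Nat.mul_le_mul_right _ (by omega)
    nlinarith
  · simp [T]
  · simp [T, hz]

/-- A subunital is invariant under the translations with center at infinity that map one of its
points to another one. -/
lemma translate_mem (hD : IsAffineSubunital σ δ q D) (hq : 2 ≤ q)
    (hσ : ∀ x, σ (σ x) = x) (hδ : σ δ ≠ δ) {z w η η' ζ : K}
    (h : (z, η) ∈ D) (h' : (z, η') ∈ D) (hw : (w, ζ) ∈ D) : (w, ζ + (η' - η)) ∈ D := by
  have main : ∀ {z w η η' ζ : K}, (z, η) ∈ D → (z, η') ∈ D → (w, ζ) ∈ D → z ≠ w →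
      (w, ζ + (η' - η)) ∈ D := by
    intro z w η η' ζ h h' hw hzw
    have hwz : w - z ≠ 0 := sub_ne_zero.2 hzw.symm
    set M := {m | ∃ η, (z, η) ∈ D ∧ (w, η + m * (w - z)) ∈ D} with hM
    have hsub : (fun ξ => (ξ - η') / (w - z)) '' {ξ | (w, ξ) ∈ D} ⊆ M := by
      rintro _ ⟨ξ, hξ, rfl⟩
      refine ⟨η', h', ?_⟩
      rw [div_mul_cancel₀ _ hwz]
      simpa using hξ
    have hinj : Function.Injective (fun ξ => (ξ - η') / (w - z)) := by
      intro a b hab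
      have := (div_left_inj' hwz).1 hab
      simpa using this
    have heq := Set.eq_of_subset_of_ncard_le hsub (by
      rw [Set.ncard_image_of_injective _ hinj, hD.fiber _ _ hw]
      exact hD.ncard_slopes_le hq hσ hδ hzw) (Set.toFinite _)
    have hm : (ζ - η) / (w - z) ∈ M := ⟨η, h, by
      rw [div_mul_cancel₀ _ hwz]; simpa using hw⟩
    rw [← heq] at hm
    obtain ⟨ξ, hξ, e⟩ := hm
    have e' := (div_left_inj' hwz).1 e
    have : ζ + (η' - η) = ξ := by linear_combination -e'
    rw [this]; exact hξ
  by_cases hzw : z = w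
  · subst hzw
    obtain ⟨u, ⟨⟨u, ξ⟩, hu, rfl⟩, huz⟩ : ∃ u ∈ Prod.fst '' D, u ≠ z := by
      apply Set.exists_ne_of_one_lt_ncard
      rw [hD.ncard_image_fst hq]
      nlinarith
    have := main h h' hu huz.symm
    have := main hu this hw huz
    simpa using this
  · exact main h h' hw hzw

omit [Finite K] in
/-- Unitary affine coordinate changes fixing the point at infinity preserve subunitals. -/
lemma affine (hD : IsAffineSubunital σ δ q D) (hσ : ∀ x, σ (σ x) = x) {z₀ η₀ : K}
    (h₀ : (z₀, η₀) ∈ D) {w l : K} (hw : w ≠ 0) (hl : l ≠ 0) (hσl : σ l = l) :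
    IsAffineSubunital σ (δ * (w * σ w) / l) q
      {p | (z₀ + w * p.1, η₀ + l * p.2 + (σ δ - δ) * σ z₀ * w * p.1) ∈ D} := by
  have hwinj : Function.Injective fun z => z₀ + w * z := fun a b h => by
    simpa [hw] using h
  refine ⟨fun z η h => ?_, ?_, fun z η h => ?_, fun m n h => ?_⟩
  · have r := hD.real _ _ h
    have r₀ := hD.real _ _ h₀
    obtain ⟨k, hk⟩ : ∃ k, k * l = 1 := ⟨l⁻¹, inv_mul_cancel₀ hl⟩
    have hk' : σ k * l = 1 := by rw [← hσl, ← map_mul, hk, map_one]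
    have hσk : σ k = k := mul_right_cancel₀ hl (hk'.trans hk.symm)
    have : δ * (w * σ w) / l = δ * (w * σ w) * k := by
      rw [div_eq_iff hl, mul_assoc, hk, mul_one]
    rw [this]
    simp only [map_add, map_mul, map_sub, hσ, hσk, hσl] at r r₀ ⊢
    linear_combination k * (r - r₀) + (η - σ η) * hk
  · rw [← hD.card]
    apply Set.ncard_congr
      (fun p _ => (z₀ + w * p.1, η₀ + l * p.2 + (σ δ - δ) * σ z₀ * w * p.1))
    · exact fun p hp => hp
    · rintro ⟨a, b⟩ ⟨c, d⟩ - - h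
      obtain ⟨h1, h2⟩ := Prod.ext_iff.1 h
      obtain rfl : a = c := hwinj h1
      simpa [hl] using h2
    · rintro ⟨a, b⟩ hab
      have e1 : z₀ + w * ((a - z₀) / w) = a := by field_simp; ring
      have e2 : η₀ + l * ((b - η₀ - (σ δ - δ) * σ z₀ * (a - z₀)) / l)
        + (σ δ - δ) * σ z₀ * w * ((a - z₀) / w) = b := by field_simp; ring
      exact ⟨((a - z₀) / w, (b - η₀ - (σ δ - δ) * σ z₀ * (a - z₀)) / l),
        by simpa [e1, e2] using hab, by simp [e1, e2]⟩
  · rw [← hD.fiber _ _ h]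
    apply Set.ncard_congr (fun ξ _ => η₀ + l * ξ + (σ δ - δ) * σ z₀ * w * z)
    · exact fun p hp => hp
    · intro a b _ _ h
      simpa [hl] using h
    · intro b hb
      have e2 : η₀ + l * ((b - η₀ - (σ δ - δ) * σ z₀ * w * z) / l)
        + (σ δ - δ) * σ z₀ * w * z = b := by field_simp; ring
      exact ⟨(b - η₀ - (σ δ - δ) * σ z₀ * w * z) / l, by simpa [e2] using hb, e2⟩
  · obtain ⟨M, hM⟩ : ∃ M, M * w = l * m + (σ δ - δ) * σ z₀ * w :=
      ⟨(l * m + (σ δ - δ) * σ z₀ * w) / w, div_mul_cancel₀ _ hw⟩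
    have e : ∀ z, η₀ + l * (m * z + n) + (σ δ - δ) * σ z₀ * w * z =
        M * (z₀ + w * z) + (η₀ + l * n - M * z₀) := fun z => by
      linear_combination -z * hM
    have himg : (fun z => z₀ + w * z) '' {z | (z, m * z + n) ∈
        {p : K × K | (z₀ + w * p.1, η₀ + l * p.2 + (σ δ - δ) * σ z₀ * w * p.1) ∈ D}} =
        {z | (z, M * z + (η₀ + l * n - M * z₀)) ∈ D} := by
      ext y
      constructor
      · rintro ⟨z, hz, rfl⟩
        simpa [e] using hz
      · intro hy
        have e1 : z₀ + w * ((y - z₀) / w) = y := by field_simp; ring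
        refine ⟨(y - z₀) / w, ?_, e1⟩
        simp only [Set.mem_ofPred_eq, e, e1]
        exact hy
    rw [← Set.ncard_image_of_injective _ hwinj, himg]
    apply hD.line
    rw [← himg]
    exact h.image hwinj

omit [Finite K] in
lemma eq_zero_of_snd_eq_zero (hD : IsAffineSubunital σ δ q D) (hδ : σ δ ≠ δ)
    (hσ : ∀ x, σ (σ x) = x) {z : K} (h : (z, 0) ∈ D) : z = 0 := by
  by_contra hz
  have r := hD.real _ _ h
  simp only [map_add, map_mul, hσ, map_zero] at r
  have : σ z ≠ 0 := (map_ne_zero σ).2 hz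
  exact mul_ne_zero (sub_ne_zero.2 hδ) (mul_ne_zero hz this) (by linear_combination r)

/-- The unitary map interchanging the origin with the point at infinity preserves subunitals. -/
lemma inversion (hD : IsAffineSubunital σ δ q D) (hσ : ∀ x, σ (σ x) = x)
    (hδ : σ δ ≠ δ) (h₀ : ((0 : K), (0 : K)) ∈ D) :
    IsAffineSubunital σ δ q
      {p | (p.2 = 0 → p.1 = 0) ∧ (-p.1 / p.2, -p.2⁻¹) ∈ D} := by
  have hz : ∀ {z}, (z, (0 : K)) ∈ D → z = 0 := hD.eq_zero_of_snd_eq_zero hδ hσ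
  refine ⟨fun z η h => ?_, ?_, fun z η h => ?_, fun m n h => ?_⟩
  · obtain ⟨h1, h2⟩ := h
    simp only at h1 h2
    by_cases hη : η = 0
    · simp [hη, h1 hη]
    have r := hD.real _ _ h2
    have hση : σ η ≠ 0 := (map_ne_zero σ).2 hη
    simp only [map_add, map_mul, map_neg, map_inv₀, map_div₀, hσ] at r ⊢
    field_simp at r
    linear_combination r
  · rw [← hD.card]
    symm
    apply Set.ncard_congr (fun p _ => (p.1 / p.2, -p.2⁻¹))
    · rintro ⟨z, η⟩ h
      by_cases hη : η = 0
      · subst hη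
        simpa using h₀
      · refine ⟨fun h => ?_, ?_⟩
        · simp [hη] at h
        · have : -(z / η) / (-η⁻¹) = z := by field_simp
          simpa [this] using h
    · rintro ⟨a, b⟩ ⟨c, d⟩ h h' e
      simp only [Prod.mk.injEq, neg_inj, inv_inj] at e
      obtain ⟨e, rfl⟩ := e
      by_cases hb : b = 0
      · subst hb
        rw [hz h, hz h']
      · rw [(div_left_inj' hb).1 e]
    · rintro ⟨z, η⟩ ⟨h1, h2⟩
      simp only at h1 h2
      refine ⟨_, h2, ?_⟩
      by_cases hη : η = 0
      · simp [hη, h1 hη]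
      · simp only [Prod.mk.injEq]
        constructor
        · field_simp
        · simp
  · by_cases hz0 : z = 0
    · subst hz0
      rw [← hD.fiber _ _ h₀]
      have hinj : Function.Injective fun x : K => -x⁻¹ := fun a b h => by simpa using h
      rw [← Set.ncard_image_of_injective _ hinj]
      congr 1
      ext x
      constructor
      · rintro ⟨y, hy, rfl⟩
        simpa using hy
      · intro hx
        refine ⟨-x⁻¹, ?_, by simp⟩
        simpa using hx
    · have hη : η ≠ 0 := fun e => hz0 (h.1 e)
      have hl := hD.line z⁻¹ 0 ⟨0, by simpa using h₀, -z / η, by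
        have : z⁻¹ * (-z / η) + 0 = -η⁻¹ := by field_simp; ring
        simpa only [Set.mem_ofPred_eq, this] using h.2, (div_ne_zero (neg_ne_zero.2 hz0) hη).symm⟩
      have : ({x | (x, z⁻¹ * x + 0) ∈ D} \ {0}).ncard = q := by
        rw [Set.ncard_sdiff_singleton_of_mem (by simpa using h₀), hl]; rfl
      rw [← this]
      symm
      have hinj : Function.Injective fun x : K => -z / x := fun a b h => by
        simpa [div_eq_mul_inv, hz0] using h
      rw [← Set.ncard_image_of_injective _ hinj]
      congr 1
      ext y
      constructor
      · rintro ⟨x, ⟨hx, hx0⟩, rfl⟩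
        have hx0 : x ≠ 0 := hx0
        refine ⟨fun h => ?_, ?_⟩
        · simp [hz0, hx0] at h
        · have e1 : -z / (-z / x) = x := by field_simp
          have e2 : -(-z / x)⁻¹ = z⁻¹ * x + 0 := by field_simp; ring
          have hx : (x, z⁻¹ * x + 0) ∈ D := hx
          simpa only [e1, e2] using hx
      · rintro ⟨h1, h2⟩
        simp only at h1 h2
        have hy : y ≠ 0 := fun e => hz0 (h1 e)
        refine ⟨-z / y, ⟨?_, ?_⟩, ?_⟩
        · have : z⁻¹ * (-z / y) + 0 = -y⁻¹ := by field_simp; ring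
          simpa only [Set.mem_ofPred_eq, this] using h2
        · simp [hz0, hy]
        · simp only; field_simp
  · by_cases hn : n = 0
    · subst hn
      obtain ⟨z, ⟨h1, h2⟩, hz0⟩ := h.exists_ne 0
      simp only [add_zero] at h1 h2
      have hm : m ≠ 0 := by
        rintro rfl
        exact hz0 (h1 (by simp))
      have e : -z / (m * z) = -m⁻¹ := by field_simp
      rw [e] at h2
      have hinj : Function.Injective fun x : K => -(m * x)⁻¹ := fun a b h => by
        simpa [hm] using h
      have hne : ∀ x, (-m⁻¹, x) ∈ D → x ≠ 0 := by
        rintro x hx rfl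
        simpa [hm] using hz hx
      have : {z | (z, m * z + 0) ∈ {p : K × K | (p.2 = 0 → p.1 = 0) ∧ (-p.1 / p.2, -p.2⁻¹) ∈ D}}
          = insert 0 ((fun x : K => -(m * x)⁻¹) '' {ξ | (-m⁻¹, ξ) ∈ D}) := by
        ext y
        constructor
        · rintro ⟨-, h2⟩
          by_cases hy : y = 0
          · exact .inl hy
          refine .inr ⟨-(m * y)⁻¹, ?_, ?_⟩
          · have e : -y / (m * y + 0) = -m⁻¹ := by field_simp; ring
            simp only [e] at h2
            simpa using h2
          · simp only; field_simp
        · rintro (rfl | ⟨x, hx, rfl⟩)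
          · simpa using h₀
          · have hx0 := hne x hx
            have e1 : m * -(m * x)⁻¹ + 0 = -x⁻¹ := by field_simp; ring
            refine ⟨?_, ?_⟩
            · simp only [e1]; simp [hx0]
            · simp only [e1]
              have e2 : - -(m * x)⁻¹ / -x⁻¹ = -m⁻¹ := by field_simp
              simp only [e2]
              simpa using hx
      rw [this, Set.ncard_insert_of_notMem, Set.ncard_image_of_injective _ hinj, hD.fiber _ _ h2]
      rintro ⟨x, hx, hx0⟩
      simp [hm, hne x hx] at hx0
    · have hne : ∀ x, (x, -(m / n) * x + -n⁻¹) ∈ D → -(m / n) * x + -n⁻¹ ≠ 0 := by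
        intro x hx e
        rw [e] at hx
        rw [hz hx] at e
        simp [hn] at e
      have hne' : ∀ z, (z, m * z + n) ∈
          {p : K × K | (p.2 = 0 → p.1 = 0) ∧ (-p.1 / p.2, -p.2⁻¹) ∈ D} → m * z + n ≠ 0 := by
        intro z hz e
        have := hz.1 e
        simp only at this
        rw [this] at e
        simp [hn] at e
      have hinj : Set.InjOn (fun z : K => -z / (m * z + n)) {z | (z, m * z + n) ∈
          {p : K × K | (p.2 = 0 → p.1 = 0) ∧ (-p.1 / p.2, -p.2⁻¹) ∈ D}} := by
        intro a ha b hb hab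
        have h1 := hne' a ha
        have h2 := hne' b hb
        simp only at hab
        rw [div_eq_div_iff h1 h2] at hab
        have : n * (a - b) = 0 := by linear_combination -hab
        simpa [hn, sub_eq_zero] using this
      have himg : (fun z : K => -z / (m * z + n)) '' {z | (z, m * z + n) ∈
          {p : K × K | (p.2 = 0 → p.1 = 0) ∧ (-p.1 / p.2, -p.2⁻¹) ∈ D}} =
          {x | (x, -(m / n) * x + -n⁻¹) ∈ D} := by
        ext x
        constructor
        · rintro ⟨z, hz, rfl⟩
          have h1 := hne' z hz
          have e : -(m / n) * (-z / (m * z + n)) + -n⁻¹ = -(m * z + n)⁻¹ := by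
            field_simp; ring
          simp only [Set.mem_ofPred_eq, e]
          exact hz.2
        · intro hx
          have h1 := hne x hx
          obtain ⟨y, hy⟩ : ∃ y, y = -(m / n) * x + -n⁻¹ := ⟨_, rfl⟩
          have hyn : y * n = -m * x - 1 := by rw [hy]; field_simp; ring
          have hx' : (x, y) ∈ D := by rw [hy]; exact hx
          rw [← hy] at h1
          have e : m * (x / y) + n = -y⁻¹ := by
            field_simp; linear_combination hyn
          refine ⟨x / y, ⟨?_, ?_⟩, ?_⟩
          · simp only [e]; simp [h1]
          · simp only [e]
            have e2 : -(x / y) / -y⁻¹ = x := by field_simp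
            simpa [e2] using hx'
          · simp only [e]; field_simp
      rw [← hinj.ncard_image, himg]
      apply hD.line
      rw [← himg]
      exact h.image_of_injOn hinj

end IsAffineSubunital

/-- A subset of a finite field closed under the ring operations is a subfield. -/
lemma exists_subfield_of_finite {K : Type*} [Field K] [Finite K] {S : Set K}
    (one : 1 ∈ S) (add : ∀ x ∈ S, ∀ y ∈ S, x + y ∈ S) (neg : ∀ x ∈ S, -x ∈ S)
    (mul : ∀ x ∈ S, ∀ y ∈ S, x * y ∈ S) : ∃ E : Subfield K, (E : Set K) = S := by
  have := Fintype.ofFinite K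
  have zero : (0 : K) ∈ S := by
    have := add _ one _ (neg _ one)
    rwa [add_neg_cancel] at this
  have pow : ∀ x ∈ S, ∀ n : ℕ, x ^ n ∈ S := by
    intro x hx n
    induction n with
    | zero => simpa using one
    | succ n ih => rw [pow_succ]; exact mul _ ih _ hx
  refine ⟨{ carrier := S, mul_mem' := fun ha hb => mul _ ha _ hb, one_mem' := one,
            add_mem' := fun ha hb => add _ ha _ hb, zero_mem' := zero,
            neg_mem' := fun {x} hx => neg x hx, inv_mem' := ?_ }, rfl⟩
  intro x hx
  by_cases hx0 : x = 0
  · simpa [hx0] using zero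
  · have h := FiniteField.pow_card_sub_one_eq_one x hx0
    have hc : Fintype.card K - 1 = Fintype.card K - 2 + 1 := by
      have := Fintype.one_lt_card (α := K)
      omega
    rw [hc, pow_succ] at h
    rw [← eq_inv_of_mul_eq_one_left h]
    exact pow x hx _

/-- The elements of a finite subfield of order `n` are the roots of `X ^ n - X`. -/
lemma mem_subfield_iff_pow_card_eq {K : Type*} [Field K] [Finite K] (E : Subfield K) (x : K) :
    x ∈ E ↔ x ^ Nat.card E = x := by
  classical
  have := Fintype.ofFinite K
  have := Fintype.ofFinite E
  have h1 : 1 < Nat.card E := Finite.one_lt_card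
  have hsub : (E : Set K) ⊆ {y | y ^ Nat.card E = y} := by
    intro y hy
    have := FiniteField.pow_card (⟨y, hy⟩ : E)
    rw [← Nat.card_eq_fintype_card] at this
    simpa using congrArg Subtype.val this
  have hle : {y : K | y ^ Nat.card E = y}.ncard ≤ (E : Set K).ncard := by
    have hne := FiniteField.X_pow_card_sub_X_ne_zero K h1
    have hs : {y : K | y ^ Nat.card E = y} ⊆
        ((Polynomial.X ^ Nat.card E - Polynomial.X : Polynomial K).roots.toFinset : Set K) := by
      intro y hy
      have hy : y ^ Nat.card E = y := hy
      rw [Finset.mem_coe, Multiset.mem_toFinset, Polynomial.mem_roots hne]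
      simp [-Nat.card_eq_fintype_card, hy]
    refine (Set.ncard_le_ncard hs (Set.toFinite _)).trans ?_
    rw [Set.ncard_coe_finset]
    refine (Multiset.toFinset_card_le _).trans ((Polynomial.card_roots' _).trans ?_)
    rw [FiniteField.X_pow_card_sub_X_natDegree_eq K h1]
    rfl
  have := Set.eq_of_subset_of_ncard_le hsub hle (Set.toFinite _)
  change x ∈ (E : Set K) ↔ _
  rw [this]
  rfl

namespace IsAffineSubunital

variable {K : Type*} [Field K] [Finite K] {σ : K →+* K} {δ : K} {q : ℕ} {D : Set (K × K)}

/-- The involutions of the group generated by the translations with center at infinity and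
those with center at the origin. -/
lemma swap_mem (hD : IsAffineSubunital σ δ q D) (hq : 2 ≤ q) (hσ : ∀ x, σ (σ x) = x)
    (hδ : σ δ ≠ δ) (h₀ : ((0 : K), (0 : K)) ∈ D) {a z η : K} (ha : (0, a) ∈ D)
    (h : (z, η) ∈ D) (hη : η ≠ 0) : (-(a * z) / η, -a ^ 2 / η) ∈ D := by
  by_cases ha0 : a = 0
  · simpa [ha0] using h₀
  have hI := hD.inversion hσ hδ h₀
  set D' : Set (K × K) := {p | (p.2 = 0 → p.1 = 0) ∧ (-p.1 / p.2, -p.2⁻¹) ∈ D} with hD'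
  have toD' : ∀ {x y : K}, (x, y) ∈ D → y ≠ 0 → (x / y, -y⁻¹) ∈ D' := by
    intro x y hxy hy
    refine ⟨fun e => ?_, ?_⟩
    · simp [hy] at e
    · have : -(x / y) / -y⁻¹ = x := by field_simp
      simpa [this] using hxy
  have h00 : ((0 : K), (0 : K)) ∈ D' := ⟨fun _ => rfl, by simpa using h₀⟩
  have ha' : (0, -a⁻¹) ∈ D' := by simpa using toD' ha ha0
  have hsh : (z, η + a) ∈ D := by simpa using hD.translate_mem hq hσ hδ h₀ ha h
  by_cases hηa : η + a = 0
  · rw [hηa] at hsh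
    obtain rfl := hD.eq_zero_of_snd_eq_zero hδ hσ hsh
    obtain rfl : η = -a := eq_neg_of_add_eq_zero_left hηa
    have : -a ^ 2 / -a = a := by field_simp
    simpa [this] using ha
  · have h1 := hI.translate_mem hq hσ hδ ha' h00 (toD' hsh hηa)
    have e : -(η + a)⁻¹ + (0 - -a⁻¹) = η / (a * (η + a)) := by field_simp; ring
    rw [e] at h1
    have h2 := h1.2
    simp only at h2
    have h3 := hD.translate_mem hq hσ hδ h₀ ha h2
    have e1 : -(z / (η + a)) / (η / (a * (η + a))) = -(a * z) / η := by field_simp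
    have e2 : -(η / (a * (η + a)))⁻¹ + (a - 0) = -a ^ 2 / η := by field_simp; ring
    rwa [e1, e2] at h3

/-- The points on a secant through the point at infinity form an affine line over a subfield. -/
lemma exists_subfield (hD : IsAffineSubunital σ δ q D) (hq : 2 ≤ q) (hσ : ∀ x, σ (σ x) = x)
    (hδ : σ δ ≠ δ) (h₀ : ((0 : K), (0 : K)) ∈ D) (h₁ : ((0 : K), (1 : K)) ∈ D) :
    ∃ F : Subfield K, ∀ a, a ∈ F ↔ (0, a) ∈ D := by
  set A : Set K := {a | (0, a) ∈ D} with hA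
  have zero : (0 : K) ∈ A := h₀
  have add : ∀ x ∈ A, ∀ y ∈ A, x + y ∈ A := fun x hx y hy => by
    have : (0, x + y) ∈ D := by simpa using hD.translate_mem hq hσ hδ h₀ hy hx
    exact this
  have neg : ∀ x ∈ A, -x ∈ A := fun x hx => by
    have : (0, -x) ∈ D := by simpa using hD.translate_mem hq hσ hδ hx h₀ h₀
    exact this
  have inv : ∀ x ∈ A, x⁻¹ ∈ A := fun x hx => by
    by_cases h : x = 0
    · simpa [h] using zero
    · have : (0, -(x⁻¹)) ∈ D := by
        simpa [neg_div] using hD.swap_mem hq hσ hδ h₀ h₁ hx h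
      simpa using neg _ this
  have sqmul : ∀ x ∈ A, ∀ y ∈ A, x ^ 2 * y ∈ A := fun x hx y hy => by
    by_cases h : y = 0
    · simpa [h] using zero
    · have : (0, -(x ^ 2 * y)) ∈ D := by
        simpa [div_eq_mul_inv] using
          hD.swap_mem hq hσ hδ h₀ hx (inv y hy) (inv_ne_zero h)
      simpa using neg _ this
  have sq : ∀ x ∈ A, x ^ 2 ∈ A := fun x hx => by simpa using sqmul x hx 1 h₁
  have mul : ∀ x ∈ A, ∀ y ∈ A, x * y ∈ A := by
    intro x hx y hy
    by_cases h2 : (2 : K) = 0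
    · have hmaps : Set.MapsTo (fun x : K => x ^ 2) A A := fun x hx => sq x hx
      have hinj : Set.InjOn (fun x : K => x ^ 2) A := by
        intro a _ b _ hab
        have : (a - b) ^ 2 = 0 := by
          simp only at hab
          linear_combination hab + (b ^ 2 - a * b) * h2
        exact sub_eq_zero.1 (pow_eq_zero_iff two_ne_zero |>.1 this)
      obtain ⟨c, hc, rfl⟩ := ((Set.toFinite A).injOn_iff_bijOn_of_mapsTo hmaps |>.1 hinj).surjOn hx
      exact sqmul c hc y hy
    · have hx2 : x / 2 ∈ A := by
        have := inv _ (add _ (inv x hx) _ (inv x hx))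
        have e : (x⁻¹ + x⁻¹)⁻¹ = x / 2 := by rw [← two_mul, mul_inv, inv_inv]; ring
        rwa [e] at this
      have := add _ (add _ (sq _ (add _ hx2 _ hy)) _ (neg _ (sq _ hx2))) _ (neg _ (sq _ hy))
      have e : (x / 2 + y) ^ 2 + -(x / 2) ^ 2 + -y ^ 2 = x * y := by
        field_simp; ring
      rwa [e] at this
  obtain ⟨F, hF⟩ := exists_subfield_of_finite (S := A) h₁ add neg mul
  exact ⟨F, fun a => by change a ∈ (F : Set K) ↔ _; rw [hF]; rfl⟩

lemma smul_mem (hD : IsAffineSubunital σ δ q D) (hq : 2 ≤ q) (hσ : ∀ x, σ (σ x) = x)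
    (hδ : σ δ ≠ δ) (h₀ : ((0 : K), (0 : K)) ∈ D) (h₁ : ((0 : K), (1 : K)) ∈ D) {a z η : K}
    (ha : (0, a) ∈ D) (h : (z, η) ∈ D) : (a * z, a ^ 2 * η) ∈ D := by
  by_cases hη : η = 0
  · subst hη
    obtain rfl := hD.eq_zero_of_snd_eq_zero hδ hσ h
    simpa using h₀
  have ha' : (0, -a) ∈ D := by simpa using hD.translate_mem hq hσ hδ ha h₀ h₀
  have h2 := hD.swap_mem hq hσ hδ h₀ ha' (hD.swap_mem hq hσ hδ h₀ h₁ h hη)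
    (div_ne_zero (by simp) hη)
  have e1 : -(-a * (-(1 * z) / η)) / (-1 ^ 2 / η) = a * z := by field_simp
  have e2 : -(-a) ^ 2 / (-1 ^ 2 / η) = a ^ 2 * η := by field_simp
  rwa [e1, e2] at h2

lemma lineMap_mem (hD : IsAffineSubunital σ δ q D) (hq : 2 ≤ q) (hσ : ∀ x, σ (σ x) = x)
    (hδ : σ δ ≠ δ) (h₀ : ((0 : K), (0 : K)) ∈ D) (h₁ : ((0 : K), (1 : K)) ∈ D) {a z w : K}
    (ha : (0, a) ∈ D) (hz : z ∈ Prod.fst '' D) (hw : w ∈ Prod.fst '' D) :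
    z + a * (w - z) ∈ Prod.fst '' D := by
  obtain ⟨⟨z, η⟩, hz, rfl⟩ := hz
  obtain ⟨⟨w, ζ⟩, hw, rfl⟩ := hw
  have hT := hD.affine hσ hz one_ne_zero one_ne_zero (map_one σ)
  have hfib : ∀ {b : K}, (0, b) ∈ D → (z, η + b) ∈ D := fun hb => by
    simpa using hD.translate_mem hq hσ hδ h₀ hb hz
  have := hT.smul_mem hq hσ (a := a) (z := w - z)
    (η := ζ - η - (σ δ - δ) * σ z * (w - z)) (by simpa using hδ) (by simpa using hz)
    (by simpa using hfib h₁) (by simpa using hfib ha) (by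
      have e1 : z + 1 * (w - z) = w := by ring
      have e2 : η + 1 * (ζ - η - (σ δ - δ) * σ z * (w - z)) + (σ δ - δ) * σ z * 1 * (w - z) = ζ := by
        ring
      simpa only [Set.mem_ofPred_eq, e1, e2] using hw)
  exact ⟨_, this, by simp⟩

lemma div_mem (hD : IsAffineSubunital σ δ q D) (hq : 2 ≤ q) (hσ : ∀ x, σ (σ x) = x)
    (hδ : σ δ ≠ δ) (h₀ : ((0 : K), (0 : K)) ∈ D) (h₁ : ((0 : K), (1 : K)) ∈ D) {z η : K}
    (h : (z, η) ∈ D) : z / η ∈ Prod.fst '' D := by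
  by_cases hη : η = 0
  · exact ⟨_, h₀, by simp [hη]⟩
  have h1 : (0, -1) ∈ D := by simpa using hD.translate_mem hq hσ hδ h₁ h₀ h₀
  exact ⟨_, hD.swap_mem hq hσ hδ h₀ h1 h hη, by simp⟩

lemma one_add_one_eq_zero (hD : IsAffineSubunital σ δ 2 D) (hσ : ∀ x, σ (σ x) = x)
    (hδ : σ δ ≠ δ) (h₀ : ((0 : K), (0 : K)) ∈ D) (h₁ : ((0 : K), (1 : K)) ∈ D) :
    (1 : K) + 1 = 0 := by
  have hs : ({0, 1} : Set K) ⊆ {ξ | (0, ξ) ∈ D} := by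
    rintro _ (rfl | rfl) <;> assumption
  have he := Set.eq_of_subset_of_ncard_le hs
    (by rw [hD.fiber _ _ h₀, Set.ncard_pair zero_ne_one]) (Set.toFinite _)
  have : (1 : K) + 1 ∈ ({0, 1} : Set K) := by
    rw [he]
    simpa using hD.translate_mem le_rfl hσ hδ h₀ h₁ h₁
  rcases this with h | h
  · exact h
  · simp at h

/-- In a subunital of order two, the blocks through the point at infinity are permuted by a
Möbius transformation of order three. -/
lemma div_add_one_mem (hD : IsAffineSubunital σ δ 2 D) (hσ : ∀ x, σ (σ x) = x)
    (hδ : σ δ ≠ δ) (h₀ : ((0 : K), (0 : K)) ∈ D) (h₁ : ((0 : K), (1 : K)) ∈ D)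
    (hS : 1 ∈ Prod.fst '' D) {x : K} (hx : x ∈ Prod.fst '' D) (hx0 : x ≠ 0) (hx1 : x ≠ 1) :
    x / (x + 1) ∈ Prod.fst '' D := by
  obtain ⟨⟨_, θ⟩, hθ, rfl⟩ := hS
  have two := hD.one_add_one_eq_zero hσ hδ h₀ h₁
  have hθr : σ θ ≠ θ := by
    intro h
    have r := hD.real _ _ hθ
    simp only [map_add, map_mul, map_one, h] at r
    exact hδ (by linear_combination r)
  have hθ0 : θ ≠ 0 := by rintro rfl; simp at hθr
  have hθ1 : θ ≠ 1 := by rintro rfl; simp at hθr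
  have hθ1' : θ + 1 ≠ 0 := fun h => hθ1 (by linear_combination h - two)
  have hθ' : (1, θ + 1) ∈ D := by simpa using hD.translate_mem le_rfl hσ hδ h₀ h₁ hθ
  have m1 : θ⁻¹ ∈ Prod.fst '' D := by simpa using hD.div_mem le_rfl hσ hδ h₀ h₁ hθ
  have m2 : (θ + 1)⁻¹ ∈ Prod.fst '' D := by simpa using hD.div_mem le_rfl hσ hδ h₀ h₁ hθ'
  have hs : ({0, 1, θ⁻¹, (θ + 1)⁻¹} : Set K) ⊆ Prod.fst '' D := by
    rintro _ (rfl | rfl | rfl | rfl)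
    exacts [⟨_, h₀, rfl⟩, ⟨_, hθ, rfl⟩, m1, m2]
  have hc : ({0, 1, θ⁻¹, (θ + 1)⁻¹} : Set K).ncard = 4 := by
    rw [Set.ncard_insert_of_notMem, Set.ncard_insert_of_notMem, Set.ncard_pair]
    · simp
    · simp [hθ0, hθ1, eq_comm (a := (1 : K))]
    · simp [hθ0, hθ1', eq_comm (a := (0 : K))]
  have he := Set.eq_of_subset_of_ncard_le hs (by rw [hD.ncard_image_fst le_rfl, hc]; norm_num)
    (Set.toFinite _)
  rw [← he] at hx
  rcases hx with rfl | rfl | rfl | rfl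
  · exact absurd rfl hx0
  · exact absurd rfl hx1
  · have : θ⁻¹ / (θ⁻¹ + 1) = (θ + 1)⁻¹ := by
      have : 1 + θ ≠ 0 := by rwa [add_comm]
      field_simp; ring
    rwa [this]
  · have e : (θ + 1)⁻¹ + 1 = θ / (θ + 1) := by
      field_simp; linear_combination two
    have : (θ + 1)⁻¹ / ((θ + 1)⁻¹ + 1) = θ⁻¹ := by
      rw [e]; field_simp
    rwa [this]

lemma add_mem (hD : IsAffineSubunital σ δ q D) (hq : 2 ≤ q) (hσ : ∀ x, σ (σ x) = x)
    (hδ : σ δ ≠ δ) (h₀ : ((0 : K), (0 : K)) ∈ D) (h₁ : ((0 : K), (1 : K)) ∈ D)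
    (hS : 1 ∈ Prod.fst '' D) {z w : K} (hz : z ∈ Prod.fst '' D) (hw : w ∈ Prod.fst '' D) :
    z + w ∈ Prod.fst '' D := by
  have hS0 : 0 ∈ Prod.fst '' D := ⟨_, h₀, rfl⟩
  obtain ⟨F, hF⟩ := hD.exists_subfield hq hσ hδ h₀ h₁
  have hFc : {ξ | (0, ξ) ∈ D}.ncard = q := hD.fiber _ _ h₀
  rcases hq.eq_or_lt with rfl | hq'
  · have two := hD.one_add_one_eq_zero hσ hδ h₀ h₁
    have hcard := hD.ncard_image_fst hq
    obtain ⟨x, hx, hx01⟩ : ∃ x ∈ Prod.fst '' D, x ∉ ({0, 1} : Set K) := by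
      by_contra! hcon
      have := Set.ncard_le_ncard hcon (Set.toFinite _)
      rw [hcard, Set.ncard_pair zero_ne_one] at this
      omega
    have hx0 : x ≠ 0 := fun h => hx01 (.inl h)
    have hx1 : x ≠ 1 := fun h => hx01 (.inr h)
    have hx1' : x + 1 ≠ 0 := fun h => hx1 (by linear_combination h - two)
    have hy := hD.div_add_one_mem hσ hδ h₀ h₁ hS hx hx0 hx1
    have hinv : x⁻¹ ∈ Prod.fst '' D := by
      obtain ⟨⟨_, θ⟩, hθ, rfl⟩ := hS
      obtain ⟨⟨x, ξ⟩, hx, rfl⟩ := hx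
      have hT := hD.affine hσ hθ one_ne_zero one_ne_zero (map_one σ)
      have e0 : (1 : K) + 1 * 1 = 0 := by linear_combination two
      have ex : 1 + 1 * (x + 1) = x := by linear_combination two
      have := hT.div_add_one_mem hσ (x := x + 1) (by simpa using hδ) (by simpa using hθ)
        (by simpa using hD.translate_mem le_rfl hσ hδ h₀ h₁ hθ)
        ⟨(1, -θ - (σ δ - δ) * σ 1 * 1 * 1), by
          have e2 : θ + 1 * (-θ - (σ δ - δ) * σ 1 * 1 * 1) + (σ δ - δ) * σ 1 * 1 * 1 = 0 := by
            ring
          simpa only [Set.mem_ofPred_eq, e0, e2] using h₀, rfl⟩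
        ⟨(x + 1, ξ - θ - (σ δ - δ) * σ 1 * 1 * (x + 1)), by
          have e2 : θ + 1 * (ξ - θ - (σ δ - δ) * σ 1 * 1 * (x + 1))
            + (σ δ - δ) * σ 1 * 1 * (x + 1) = ξ := by ring
          simpa only [Set.mem_ofPred_eq, ex, e2] using hx, rfl⟩ hx1'
          (by simpa using hx0)
      obtain ⟨⟨_, ζ⟩, hζ, rfl⟩ := this
      refine ⟨_, hζ, ?_⟩
      have e : x + 1 + 1 = x := by linear_combination two
      simp only at hx0
      simp only [e]
      field_simp
      linear_combination x * two
    have hs : ({0, 1, x, x / (x + 1)} : Set K) ⊆ Prod.fst '' D := by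
      rintro _ (rfl | rfl | rfl | rfl) <;> assumption
    have hc : ({0, 1, x, x / (x + 1)} : Set K).ncard = 4 := by
      rw [Set.ncard_insert_of_notMem, Set.ncard_insert_of_notMem, Set.ncard_pair]
      · intro h
        rw [eq_div_iff hx1'] at h
        exact hx0 (by simpa using (by linear_combination h : x * x = 0))
      · simp [hx1.symm, eq_div_iff hx1']
      · simp [hx0.symm, eq_div_iff hx1']
    have he := Set.eq_of_subset_of_ncard_le hs (by rw [hcard, hc]; norm_num) (Set.toFinite _)
    have hxx : x * x = x + 1 := by
      rw [← he] at hinv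
      rcases hinv with h | h | h | h
      · exact absurd h (inv_ne_zero hx0)
      · exact absurd (inv_eq_one.1 h) hx1
      · have h1 : x * x = 1 := by
          have h2 := mul_inv_cancel₀ hx0
          rwa [h] at h2
        have : (x + 1) * (x + 1) = 0 := by linear_combination h1 + (1 + x) * two
        exact absurd (by simpa using this) hx1'
      · have h : x⁻¹ = x / (x + 1) := h
        field_simp at h
        linear_combination -h
    have hdiv : x / (x + 1) = x + 1 := by
      field_simp
      linear_combination -hxx - (1 + x) * two
    rw [hdiv] at he
    rw [← he] at hz hw ⊢
    simp only [Set.mem_insert_iff, Set.mem_singleton_iff] at hz hw ⊢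
    grind
  · obtain ⟨a, ha, ha01⟩ : ∃ a ∈ {ξ | (0, ξ) ∈ D}, a ∉ ({0, 1} : Set K) := by
      by_contra! hcon
      have := Set.ncard_le_ncard hcon (Set.toFinite _)
      rw [hFc, Set.ncard_pair zero_ne_one] at this
      omega
    have ha0 : a ≠ 0 := fun h => ha01 (.inl h)
    have ha1 : 1 - a ≠ 0 := fun h => ha01 (.inr (sub_eq_zero.1 h).symm)
    have haF : a ∈ F := (hF a).2 ha
    have hz' := hD.lineMap_mem hq hσ hδ h₀ h₁ ((hF _).1 (F.inv_mem haF)) hS0 hz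
    have hw' := hD.lineMap_mem hq hσ hδ h₀ h₁
      ((hF _).1 (F.inv_mem (F.sub_mem F.one_mem haF))) hS0 hw
    have := hD.lineMap_mem hq hσ hδ h₀ h₁ ha hw' hz'
    convert this using 1
    field_simp
    ring

/-- The blocks through the point at infinity are parametrized by a subfield of order `q ^ 2`. -/
lemma exists_subfield_image_fst (hD : IsAffineSubunital σ δ q D) (hq : 2 ≤ q)
    (hσ : ∀ x, σ (σ x) = x) (hδ : σ δ ≠ δ) (h₀ : ((0 : K), (0 : K)) ∈ D)
    (h₁ : ((0 : K), (1 : K)) ∈ D) {θ : K} (hθ : (1, θ) ∈ D) :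
    ∃ E : Subfield K, (E : Set K) = Prod.fst '' D ∧ θ ∈ E ∧
      ∀ x, x ∈ E ∧ σ x = x ↔ (0, x) ∈ D := by
  obtain ⟨F, hF⟩ := hD.exists_subfield hq hσ hδ h₀ h₁
  set S := Prod.fst '' D with hS
  have one : 1 ∈ S := ⟨_, hθ, rfl⟩
  have add : ∀ x ∈ S, ∀ y ∈ S, x + y ∈ S := fun x hx y hy => hD.add_mem hq hσ hδ h₀ h₁ one hx hy
  have smul : ∀ a ∈ F, ∀ x ∈ S, a * x ∈ S := by
    rintro a ha _ ⟨⟨x, ξ⟩, hx, rfl⟩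
    exact ⟨_, hD.smul_mem hq hσ hδ h₀ h₁ ((hF a).1 ha) hx, rfl⟩
  have hFr : ∀ a ∈ F, σ a = a := fun a ha => by
    simpa using hD.real _ _ ((hF a).1 ha)
  have hθr : σ θ ≠ θ := by
    intro h
    have r := hD.real _ _ hθ
    simp only [map_add, map_mul, map_one, h] at r
    exact hδ (by linear_combination r)
  have hθ0 : θ ≠ 0 := by rintro rfl; simp at hθr
  have hθ1' : θ + 1 ≠ 0 := fun h => by
    obtain rfl := eq_neg_of_add_eq_zero_left h
    simp at hθr
  obtain ⟨φ, hφ⟩ : ∃ φ, φ = θ⁻¹ := ⟨_, rfl⟩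
  have hφ0 : φ ≠ 0 := by rw [hφ]; exact inv_ne_zero hθ0
  have hφr : σ φ ≠ φ := by rw [hφ, map_inv₀]; simpa using hθr
  have hφS : φ ∈ S := by
    rw [hφ, ← one_div]
    exact hD.div_mem hq hσ hδ h₀ h₁ hθ
  have hφS' : φ / (φ + 1) ∈ S := by
    have := hD.div_mem hq hσ hδ h₀ h₁ (by simpa using hD.translate_mem hq hσ hδ h₀ h₁ hθ :
      (1, θ + 1) ∈ D)
    have e : φ / (φ + 1) = 1 / (θ + 1) := by
      have : 1 + θ ≠ 0 := by rwa [add_comm]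
      rw [hφ]; field_simp; ring
    rwa [e]
  have hindep : ∀ a ∈ F, ∀ b ∈ F, σ (a + b * φ) = a + b * φ → b = 0 := by
    intro a ha b hb h
    rw [map_add, map_mul, hFr a ha, hFr b hb] at h
    by_contra hb0
    exact hφr (mul_left_cancel₀ hb0 (by linear_combination h))
  have hFc : (F : Set K).ncard = q := by
    rw [← hD.fiber _ _ h₀]
    congr 1
    ext a
    exact hF a
  have hSeq : (fun p : K × K => p.1 + p.2 * φ) '' ((F : Set K) ×ˢ (F : Set K)) = S := by
    apply Set.eq_of_subset_of_ncard_le _ _ (Set.toFinite _)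
    · rintro _ ⟨⟨a, b⟩, ⟨ha, hb⟩, rfl⟩
      have := add _ (smul a ha 1 one) _ (smul b hb φ hφS)
      simpa using this
    · rw [hD.ncard_image_fst hq, Set.InjOn.ncard_image, Set.ncard_prod, hFc, sq]
      rintro ⟨a, b⟩ ⟨ha, hb⟩ ⟨c, d⟩ ⟨hc, hd⟩ h
      simp only at ha hb hc hd h
      have h' : (a - c) + (b - d) * φ = 0 := by linear_combination h
      have hbd := sub_eq_zero.1 (hindep _ (F.sub_mem ha hc) _ (F.sub_mem hb hd) (by simp [h']))
      subst hbd
      simpa [sub_eq_zero] using h'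
  have rep : ∀ x ∈ S, ∃ a ∈ F, ∃ b ∈ F, a + b * φ = x := by
    intro x hx
    rw [← hSeq] at hx
    obtain ⟨⟨a, b⟩, ⟨ha, hb⟩, rfl⟩ := hx
    exact ⟨a, ha, b, hb, rfl⟩
  have neg : ∀ x ∈ S, -x ∈ S := fun x hx => by
    simpa using smul _ (F.neg_mem F.one_mem) x hx
  have hφ1 : φ + 1 ≠ 0 := fun h => by
    obtain rfl := eq_neg_of_add_eq_zero_left h
    simp at hφr
  have sq_mem : φ * φ ∈ S := by
    obtain ⟨a, ha, b, hb, h⟩ := rep _ hφS'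
    rw [eq_div_iff hφ1] at h
    have hb0 : b ≠ 0 := by
      rintro rfl
      have h2 : a + (a - 1) * φ = 0 := by linear_combination h
      have := hindep _ ha _ (F.sub_mem ha F.one_mem) (by simp [h2])
      rw [this] at h2
      rw [sub_eq_zero] at this
      simp [this] at h2
    have e : φ * φ = b⁻¹ * (φ + -(a * 1 + (a + b) * φ)) := by
      field_simp
      linear_combination h
    rw [e]
    exact smul _ (F.inv_mem hb) _ (add _ hφS _ (neg _ (add _ (smul _ ha _ one) _
      (smul _ (F.add_mem ha hb) _ hφS))))
  have mul : ∀ x ∈ S, ∀ y ∈ S, x * y ∈ S := by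
    intro x hx y hy
    obtain ⟨a, ha, b, hb, rfl⟩ := rep x hx
    obtain ⟨c, hc, d, hd, rfl⟩ := rep y hy
    have e : (a + b * φ) * (c + d * φ) = (a * c) * 1 + (a * d + b * c) * φ + (b * d) * (φ * φ) := by
      ring
    rw [e]
    exact add _ (add _ (smul _ (F.mul_mem ha hc) _ one) _
      (smul _ (F.add_mem (F.mul_mem ha hd) (F.mul_mem hb hc)) _ hφS)) _
      (smul _ (F.mul_mem hb hd) _ sq_mem)
  obtain ⟨E, hE⟩ := exists_subfield_of_finite one add neg mul
  have hE' : ∀ x, x ∈ E ↔ x ∈ S := fun x => by rw [← hE]; rfl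
  refine ⟨E, hE, ?_, fun x => ?_⟩
  · rw [← inv_inv θ, ← hφ]
    exact E.inv_mem ((hE' φ).2 hφS)
  · rw [← hF x]
    constructor
    · rintro ⟨hx, hxr⟩
      obtain ⟨a, ha, b, hb, rfl⟩ := rep x ((hE' x).1 hx)
      simpa [hindep a ha b hb hxr] using ha
    · intro hx
      exact ⟨(hE' x).2 (by simpa using smul x hx 1 one), hFr x hx⟩

/-- A normalized subunital consists of the points with coordinates in a subfield on a
hermitian curve. -/
lemma eq_of_normalized (hD : IsAffineSubunital σ δ q D) (hq : 2 ≤ q)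
    (hσ : ∀ x, σ (σ x) = x) (hδ : σ δ ≠ δ) (h₀ : ((0 : K), (0 : K)) ∈ D)
    (h₁ : ((0 : K), (1 : K)) ∈ D) {θ : K} (hθ : (1, θ) ∈ D) :
    ∃ E : Subfield K, Nat.card E = q ^ 2 ∧ {x | x ∈ E ∧ σ x = x}.ncard = q ∧ θ ∈ E ∧ σ θ ≠ θ ∧
      ∀ z η, (z, η) ∈ D ↔ z ∈ E ∧ η - θ * (z * σ z) ∈ E ∧
        σ (η - θ * (z * σ z)) = η - θ * (z * σ z) := by
  obtain ⟨E, hE, hθE, hR⟩ := hD.exists_subfield_image_fst hq hσ hδ h₀ h₁ hθ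
  have hE' : ∀ x, x ∈ E ↔ x ∈ Prod.fst '' D := fun x => by rw [← hE]; rfl
  have hEc : Nat.card E = q ^ 2 := by
    rw [← hD.ncard_image_fst hq, ← hE]; rfl
  have hRc : {x | x ∈ E ∧ σ x = x}.ncard = q := by
    rw [← hD.fiber _ _ h₀]
    congr 1
    ext x
    exact hR x
  have hr₁ := hD.real _ _ hθ
  have hθr : σ θ ≠ θ := by
    intro h
    simp only [map_add, map_mul, map_one, h] at hr₁
    exact hδ (by linear_combination hr₁)
  have hσE : ∀ x ∈ E, σ x ∈ E := fun x hx => by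
    rw [mem_subfield_iff_pow_card_eq] at hx ⊢
    rw [← map_pow, hx]
  refine ⟨E, hEc, hRc, hθE, hθr, ?_⟩
  set D₁ : Set (K × K) := {p | p.1 ∈ E ∧ p.2 - θ * (p.1 * σ p.1) ∈ E ∧
    σ (p.2 - θ * (p.1 * σ p.1)) = p.2 - θ * (p.1 * σ p.1)} with hD₁
  have hsub : D ⊆ D₁ := by
    rintro ⟨z, η⟩ h
    have hz : z ∈ E := (hE' z).2 ⟨_, h, rfl⟩
    by_cases hz0 : z = 0
    · subst hz0
      have := (hR η).2 h
      simpa [hD₁] using this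
    have hη : η ≠ 0 := by
      rintro rfl
      exact hz0 (hD.eq_zero_of_snd_eq_zero hδ hσ h)
    have hηE : η ∈ E := by
      have := (hE' _).2 (hD.div_mem hq hσ hδ h₀ h₁ h)
      have e : η = z / (z / η) := by field_simp
      rw [e]
      exact E.div_mem hz this
    refine ⟨hz, E.sub_mem hηE (E.mul_mem hθE (E.mul_mem hz (hσE z hz))), ?_⟩
    have hr := hD.real _ _ h
    simp only [map_add, map_mul, map_sub, map_one, hσ] at hr hr₁ ⊢
    linear_combination hr - z * σ z * hr₁
  have hcard : D₁.ncard = q ^ 3 := by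
    have : D₁ = (fun p : K × K => (p.1, p.2 + θ * (p.1 * σ p.1))) ''
        ((E : Set K) ×ˢ {x | x ∈ E ∧ σ x = x}) := by
      ext ⟨z, η⟩
      constructor
      · intro h
        exact ⟨(z, η - θ * (z * σ z)), h, by simp⟩
      · rintro ⟨⟨a, b⟩, ⟨ha, hb⟩, e⟩
        simp only [Prod.mk.injEq] at e ha hb
        obtain ⟨rfl, rfl⟩ := e
        simpa [hD₁] using ⟨ha, hb⟩
    rw [this, Set.InjOn.ncard_image, Set.ncard_prod, hRc]
    · have : (E : Set K).ncard = q ^ 2 := hEc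
      rw [this]; ring
    · rintro ⟨a, b⟩ - ⟨c, d⟩ - h
      simp only [Prod.mk.injEq] at h
      obtain ⟨rfl, h⟩ := h
      simpa using h
  have heq := Set.eq_of_subset_of_ncard_le hsub (by rw [hcard, hD.card]) (Set.toFinite _)
  intro z η
  rw [heq]
  rfl

/-- Up to an affine coordinate change, a subunital consists of the points with coordinates in a
subfield on a hermitian curve. -/
theorem exists_coordinates (hD : IsAffineSubunital σ δ q D) (hq : 2 ≤ q)
    (hσ : ∀ x, σ (σ x) = x) (hδ : σ δ ≠ δ) :
    ∃ (E : Subfield K) (θ z₀ η₀ w l m : K), Nat.card E = q ^ 2 ∧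
      {x | x ∈ E ∧ σ x = x}.ncard = q ∧ θ ∈ E ∧ σ θ ≠ θ ∧ w ≠ 0 ∧ l ≠ 0 ∧
      ∀ z η, (z₀ + w * z, η₀ + l * η + m * z) ∈ D ↔ z ∈ E ∧ η - θ * (z * σ z) ∈ E ∧
        σ (η - θ * (z * σ z)) = η - θ * (z * σ z) := by
  obtain ⟨⟨z₀, η₀⟩, h₀⟩ : D.Nonempty := by
    apply Set.nonempty_of_ncard_ne_zero
    rw [hD.card]
    have : 0 < q := by omega
    positivity
  obtain ⟨η₁, h₁, hne⟩ := Set.exists_ne_of_one_lt_ncard (s := {ξ | (z₀, ξ) ∈ D})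
    (by rw [hD.fiber _ _ h₀]; omega) η₀
  obtain ⟨_, ⟨⟨z₂, η₂⟩, h₂, rfl⟩, hz⟩ := Set.exists_ne_of_one_lt_ncard (s := Prod.fst '' D)
    (by rw [hD.ncard_image_fst hq]; nlinarith) z₀
  simp only at hz
  have hw : z₂ - z₀ ≠ 0 := sub_ne_zero.2 hz
  have hl : η₁ - η₀ ≠ 0 := sub_ne_zero.2 hne
  have hlr : σ (η₁ - η₀) = η₁ - η₀ := by
    have r₀ := hD.real _ _ h₀
    have r₁ := hD.real _ _ h₁
    have e : η₁ - η₀ = (η₁ + δ * (z₀ * σ z₀)) - (η₀ + δ * (z₀ * σ z₀)) := by ring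
    rw [e, map_sub, r₀, r₁]
  have hT := hD.affine hσ h₀ hw hl hlr
  have hN : (z₂ - z₀) * σ (z₂ - z₀) ≠ 0 := mul_ne_zero hw ((map_ne_zero σ).2 hw)
  obtain ⟨E, hE⟩ := hT.eq_of_normalized hq hσ
    (θ := (η₂ - η₀ - (σ δ - δ) * σ z₀ * (z₂ - z₀)) / (η₁ - η₀)) (by
      intro h
      rw [map_div₀, hlr, div_left_inj' hl, map_mul, map_mul σ (z₂ - z₀), hσ] at h
      exact hδ (mul_right_cancel₀ hN (by linear_combination h)))
    (by simpa using h₀) (by simpa using h₁) (by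
      have e1 : z₀ + (z₂ - z₀) * 1 = z₂ := by ring
      have e2 : η₀ + (η₁ - η₀) * ((η₂ - η₀ - (σ δ - δ) * σ z₀ * (z₂ - z₀)) / (η₁ - η₀)) +
          (σ δ - δ) * σ z₀ * (z₂ - z₀) * 1 = η₂ := by
        rw [mul_div_cancel₀ _ hl]; ring
      simpa only [Set.mem_ofPred_eq, e1, e2] using h₂)
  exact ⟨E, _, z₀, η₀, _, _, _, hE.1, hE.2.1, hE.2.2.1, hE.2.2.2.1, hw, hl, hE.2.2.2.2⟩

end IsAffineSubunital

section Projective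

variable {K : Type*} [Field K]

lemma ne_zero_mulVec {M : Matrix (Fin 3) (Fin 3) K} (hM : IsUnit M) {v : Fin 3 → K} (hv : v ≠ 0) :
    M.mulVec v ≠ 0 := fun h =>
  hv (Matrix.mulVec_injective_of_isUnit hM (h.trans (Matrix.mulVec_zero M).symm))

/-- The point with affine coordinates `p` in the coordinate system given by `M`. -/
def affinePoint {M : Matrix (Fin 3) (Fin 3) K} (hM : IsUnit M) (p : K × K) :
    Projectivization K (Fin 3 → K) :=
  Projectivization.mk K (M.mulVec ![1, p.2, p.1])
    (ne_zero_mulVec hM fun h => one_ne_zero (congrFun h 0))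

/-- The point at infinity of the vertical lines in the coordinate system given by `M`. -/
def infinitePoint {M : Matrix (Fin 3) (Fin 3) K} (hM : IsUnit M) :
    Projectivization K (Fin 3 → K) :=
  Projectivization.mk K (M.mulVec ![0, 1, 0])
    (ne_zero_mulVec hM fun h => one_ne_zero (congrFun h 1))

lemma affinePoint_injective {M : Matrix (Fin 3) (Fin 3) K} (hM : IsUnit M) :
    Function.Injective (affinePoint hM) := by
  rintro ⟨a, b⟩ ⟨c, d⟩ h
  obtain ⟨k, hk⟩ := (Projectivization.mk_eq_mk_iff' _ _ _ _ _).1 h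
  rw [← Matrix.mulVec_smul] at hk
  have := Matrix.mulVec_injective_of_isUnit hM hk
  have h0 := congrFun this 0
  have h1 := congrFun this 1
  have h2 := congrFun this 2
  simp at h0 h1 h2
  subst h0
  simp [← h1, ← h2]

lemma affinePoint_ne_infinitePoint {M : Matrix (Fin 3) (Fin 3) K} (hM : IsUnit M) (p : K × K) :
    affinePoint hM p ≠ infinitePoint hM := by
  intro h
  obtain ⟨k, hk⟩ := (Projectivization.mk_eq_mk_iff' _ _ _ _ _).1 h
  rw [← Matrix.mulVec_smul] at hk
  have := congrFun (Matrix.mulVec_injective_of_isUnit hM hk) 0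
  simp at this

lemma mk_mulVec_eq_affinePoint {M : Matrix (Fin 3) (Fin 3) K} (hM : IsUnit M) {v : Fin 3 → K}
    (h0 : v 0 ≠ 0) (hv : M.mulVec v ≠ 0) :
    Projectivization.mk K (M.mulVec v) hv = affinePoint hM (v 2 / v 0, v 1 / v 0) := by
  refine (Projectivization.mk_eq_mk_iff' _ _ _ _ _).2 ⟨v 0, ?_⟩
  rw [← Matrix.mulVec_smul]
  congr 1
  ext i
  fin_cases i <;> simp <;> field_simp

lemma mk_mulVec_eq_infinitePoint {M : Matrix (Fin 3) (Fin 3) K} (hM : IsUnit M) {v : Fin 3 → K}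
    (h0 : v 0 = 0) (h2 : v 2 = 0) (hv : M.mulVec v ≠ 0) :
    Projectivization.mk K (M.mulVec v) hv = infinitePoint hM := by
  refine (Projectivization.mk_eq_mk_iff' _ _ _ _ _).2 ⟨v 1, ?_⟩
  rw [← Matrix.mulVec_smul]
  congr 1
  ext i
  fin_cases i <;> simp [h0, h2]

lemma exists_eq_mk_mulVec {M : Matrix (Fin 3) (Fin 3) K} (hM : IsUnit M)
    (P : Projectivization K (Fin 3 → K)) :
    ∃ (v : Fin 3 → K) (hv : M.mulVec v ≠ 0), P = Projectivization.mk K (M.mulVec v) hv := by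
  obtain ⟨v, hv⟩ := (Matrix.mulVec_surjective_iff_isUnit.2 hM) P.rep
  have h : M.mulVec v ≠ 0 := by rw [hv]; exact P.rep_nonzero
  refine ⟨v, h, ?_⟩
  conv_lhs => rw [← P.mk_rep]
  congr 1
  exact hv.symm

lemma apply_rep_mk_eq_zero_iff (f : (Fin 3 → K) →ₗ[K] K) {v : Fin 3 → K} (hv : v ≠ 0) :
    f (Projectivization.mk K v hv).rep = 0 ↔ f v = 0 := by
  obtain ⟨a, ha⟩ := Projectivization.exists_smul_eq_mk_rep K v hv
  rw [← ha, Units.smul_def, map_smul, smul_eq_mul]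
  simp

/-- The affine part of a subunital with respect to suitable coordinates. -/
lemma isAffineSubunital_of_projective [Finite K] {σ : K →+* K} (hσ : ∀ x, σ (σ x) = x)
    {δ : K} (hδ : σ δ ≠ δ) {q : ℕ} {U : Set (Projectivization K (Fin 3 → K))}
    (hcard : U.ncard = q ^ 3 + 1)
    (hline : ∀ ℓ, IsLine K ℓ → (U ∩ ℓ).Nontrivial → (U ∩ ℓ).ncard = q + 1)
    {M : Matrix (Fin 3) (Fin 3) K} (hM : IsUnit M) (hinf : infinitePoint hM ∈ U)
    (hreal : ∀ v hv, Projectivization.mk K (M.mulVec v) hv ∈ U →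
      σ (σ (v 0) * v 1 + δ * (v 2 * σ (v 2))) = σ (v 0) * v 1 + δ * (v 2 * σ (v 2))) :
    U = insert (infinitePoint hM) (affinePoint hM '' (affinePoint hM ⁻¹' U)) ∧
      IsAffineSubunital σ δ q (affinePoint hM ⁻¹' U) := by
  have hU : U = insert (infinitePoint hM) (affinePoint hM '' (affinePoint hM ⁻¹' U)) := by
    apply subset_antisymm
    · intro P hP
      obtain ⟨v, hv, rfl⟩ := exists_eq_mk_mulVec hM P
      by_cases h0 : v 0 = 0
      · have hr := hreal v hv hP
        simp only [h0, map_mul, map_zero, zero_mul, zero_add, hσ] at hr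
        have h2 : v 2 = 0 := by
          by_contra h2
          have : σ (v 2) ≠ 0 := (map_ne_zero σ).2 h2
          exact hδ (mul_right_cancel₀ (mul_ne_zero h2 this) (by linear_combination hr))
        exact .inl (mk_mulVec_eq_infinitePoint hM h0 h2 hv)
      · rw [mk_mulVec_eq_affinePoint hM h0 hv] at hP ⊢
        exact .inr ⟨_, hP, rfl⟩
    · rintro _ (rfl | ⟨p, hp, rfl⟩)
      exacts [hinf, hp]
  have hline' : ∀ g : (Fin 3 → K) →ₗ[K] K, g ≠ 0 →
      (∃ ℓ, IsLine K ℓ ∧ ∀ v hv, Projectivization.mk K (M.mulVec v) hv ∈ ℓ ↔ g v = 0) := by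
    intro g hg
    have hMM : M⁻¹ * M = 1 := Matrix.nonsing_inv_mul _ ((Matrix.isUnit_iff_isUnit_det M).1 hM)
    have hgM : ∀ v, (g ∘ₗ M⁻¹.mulVecLin) (M.mulVec v) = g v := fun v => by
      simp [Matrix.mulVec_mulVec, hMM]
    refine ⟨_, ⟨g ∘ₗ M⁻¹.mulVecLin, fun h => hg ?_, rfl⟩, fun v hv => ?_⟩
    · refine LinearMap.ext fun v => ?_
      rw [← hgM, h]
      rfl
    · rw [Set.mem_ofPred_eq, apply_rep_mk_eq_zero_iff, hgM]
  have hinj := affinePoint_injective hM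
  have hinf' : ∀ s, infinitePoint hM ∉ affinePoint hM '' s := by
    rintro s ⟨p, -, hp⟩
    exact affinePoint_ne_infinitePoint hM p hp
  refine ⟨hU, fun z η h => ?_, ?_, fun z η h => ?_, fun m n h => ?_⟩
  · simpa using hreal _ _ h
  · rw [hU, Set.ncard_insert_of_notMem (hinf' _), Set.ncard_image_of_injective _ hinj] at hcard
    exact Nat.succ_injective hcard
  · obtain ⟨ℓ, hℓ, hmem⟩ := hline' (LinearMap.proj 2 - z • LinearMap.proj 0) (fun h => by
      have := LinearMap.congr_fun h ![0, 0, 1]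
      simp at this)
    have hi : infinitePoint hM ∈ ℓ := (hmem _ _).2 (by simp)
    have ha : ∀ p, affinePoint hM p ∈ ℓ ↔ p.1 = z := fun p => (hmem _ _).trans (by
      simp [sub_eq_zero])
    have e : U ∩ ℓ = insert (infinitePoint hM)
        ((fun ξ => affinePoint hM (z, ξ)) '' {ξ | (z, ξ) ∈ affinePoint hM ⁻¹' U}) := by
      ext P
      constructor
      · rintro ⟨hPU, hPl⟩
        rw [hU] at hPU
        rcases hPU with rfl | ⟨⟨a, b⟩, hp, rfl⟩
        · exact .inl rfl
        · obtain rfl := (ha _).1 hPl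
          exact .inr ⟨b, hp, rfl⟩
      · rintro (rfl | ⟨ξ, hξ, rfl⟩)
        · exact ⟨hinf, hi⟩
        · exact ⟨hξ, (ha _).2 rfl⟩
    have := hline ℓ hℓ ⟨_, ⟨hinf, hi⟩, _, ⟨h, (ha _).2 rfl⟩,
      (affinePoint_ne_infinitePoint hM _).symm⟩
    rw [e, Set.ncard_insert_of_notMem, Set.ncard_image_of_injective _ fun a b hab => by
      simpa using hinj hab] at this
    · exact Nat.succ_injective this
    · rintro ⟨ξ, -, hξ⟩
      exact affinePoint_ne_infinitePoint hM _ hξ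
  · obtain ⟨ℓ, hℓ, hmem⟩ := hline' (LinearMap.proj 1 - m • LinearMap.proj 2 -
      n • LinearMap.proj 0) (fun h => by
      have := LinearMap.congr_fun h ![0, 1, 0]
      simp at this)
    have hi : infinitePoint hM ∉ ℓ := fun h => by
      simpa using (hmem _ _).1 h
    have ha : ∀ p, affinePoint hM p ∈ ℓ ↔ p.2 = m * p.1 + n := fun p => (hmem _ _).trans (by
      simp [sub_sub, sub_eq_zero])
    have hinj' : Function.Injective fun z => affinePoint hM (z, m * z + n) := fun a b hab =>
      (Prod.ext_iff.1 (hinj hab)).1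
    have e : U ∩ ℓ = (fun z => affinePoint hM (z, m * z + n)) ''
        {z | (z, m * z + n) ∈ affinePoint hM ⁻¹' U} := by
      ext P
      constructor
      · rintro ⟨hPU, hPl⟩
        rw [hU] at hPU
        rcases hPU with rfl | ⟨⟨a, b⟩, hp, rfl⟩
        · exact absurd hPl hi
        · have hb : b = m * a + n := (ha _).1 hPl
          subst hb
          exact ⟨a, hp, rfl⟩
      · rintro ⟨z, hz, rfl⟩
        exact ⟨hz, (ha _).2 rfl⟩
    rw [← Set.ncard_image_of_injective _ hinj', ← e]
    apply hline ℓ hℓ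
    rw [e]
    exact h.image hinj'

/-- Coordinates in which the point at infinity of the vertical lines lies in the subunital. -/
lemma exists_adapted_coordinates {σ : K →+* K} (hσ : ∀ x, σ (σ x) = x) {ε : K} (hε : σ ε ≠ ε)
    {U : Set (Projectivization K (Fin 3 → K))} (hne : U.Nonempty)
    (hU : ∀ v hv, Projectivization.mk K v hv ∈ U →
      σ (σ (v 0) * v 1 * ε⁻¹ + ε⁻¹ * (v 2 * σ (v 2))) =
        σ (v 0) * v 1 * ε⁻¹ + ε⁻¹ * (v 2 * σ (v 2))) :
    ∃ (M : Matrix (Fin 3) (Fin 3) K) (hM : IsUnit M), infinitePoint hM ∈ U ∧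
      ∀ v hv, Projectivization.mk K (M.mulVec v) hv ∈ U →
        σ (σ (v 0) * v 1 + ε⁻¹ * (v 2 * σ (v 2))) =
          σ (v 0) * v 1 + ε⁻¹ * (v 2 * σ (v 2)) := by
  have hε0 : ε ≠ 0 := by rintro rfl; simp at hε
  by_cases h : ∃ hv, Projectivization.mk K ![0, 1, 0] hv ∈ U
  · have hM : IsUnit !![1, 0, 0; 0, ε, 0; 0, 0, (1 : K)] := by
      rw [Matrix.isUnit_iff_isUnit_det]
      simp [Matrix.det_fin_three, hε0]
    have hmul : ∀ v : Fin 3 → K, Matrix.mulVec !![1, 0, 0; 0, ε, 0; 0, 0, (1 : K)] v =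
        ![v 0, ε * v 1, v 2] := fun v => by
      ext i; fin_cases i <;> simp [Matrix.mulVec, dotProduct, Fin.sum_univ_three]
    refine ⟨_, hM, ?_, fun v hv hvU => ?_⟩
    · obtain ⟨hv, h⟩ := h
      convert h using 1
      refine (Projectivization.mk_eq_mk_iff' _ _ _ _ _).2 ⟨ε, ?_⟩
      rw [hmul]
      ext i; fin_cases i <;> simp
    · have := hU _ _ hvU
      rw [hmul] at this
      have e : σ (v 0) * (ε * v 1) * ε⁻¹ = σ (v 0) * v 1 := by field_simp
      simpa only [Matrix.cons_val, e] using this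
  · obtain ⟨P, hP⟩ := hne
    have hP' := hP
    rw [← P.mk_rep] at hP
    have hr := hU _ _ hP
    obtain ⟨u, hu⟩ : ∃ u, u = P.rep := ⟨_, rfl⟩
    have hu0 : u ≠ 0 := hu ▸ P.rep_nonzero
    simp only [← hu] at hr hP
    have hδ : σ ε⁻¹ ≠ ε⁻¹ := by rw [map_inv₀]; simpa using hε
    have h0 : u 0 ≠ 0 := by
      intro h0
      simp only [h0, map_mul, map_zero, zero_mul, zero_add, hσ] at hr
      have h2 : u 2 = 0 := by
        by_contra h2
        have : σ (u 2) ≠ 0 := (map_ne_zero σ).2 h2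
        exact hδ (mul_right_cancel₀ (mul_ne_zero h2 this) (by linear_combination hr))
      refine h ⟨fun h => one_ne_zero (congrFun h 1), ?_⟩
      convert hP using 1
      symm
      refine (Projectivization.mk_eq_mk_iff' _ _ _ _ _).2 ⟨u 1, ?_⟩
      ext i; fin_cases i <;> simp [h0, h2]
    obtain ⟨y, hy⟩ : ∃ y, y = u 1 / u 0 * ε⁻¹ := ⟨_, rfl⟩
    obtain ⟨z, hz⟩ : ∃ z, z = u 2 / u 0 := ⟨_, rfl⟩
    have hmem : ∃ hv, Projectivization.mk K ![1, ε * y, z] hv ∈ U := by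
      refine ⟨fun h => one_ne_zero (congrFun h 0), ?_⟩
      convert hP using 1
      symm
      refine (Projectivization.mk_eq_mk_iff' _ _ _ _ _).2 ⟨u 0, ?_⟩
      ext i; fin_cases i <;> simp [hy, hz] <;> field_simp
    obtain ⟨hv₀, hmem⟩ := hmem
    have hr₀ := hU _ _ hmem
    obtain ⟨m, hm⟩ : ∃ m, m = (σ ε⁻¹ - ε⁻¹) * σ z := ⟨_, rfl⟩
    have hM : IsUnit !![0, 1, 0; -ε, ε * y, ε * m; 0, z, (1 : K)] := by
      rw [Matrix.isUnit_iff_isUnit_det]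
      simp [Matrix.det_fin_three, hε0]
    have hmul : ∀ v : Fin 3 → K,
        Matrix.mulVec !![0, 1, 0; -ε, ε * y, ε * m; 0, z, (1 : K)] v =
        ![v 1, -ε * v 0 + ε * y * v 1 + ε * m * v 2, z * v 1 + v 2] := fun v => by
      ext i; fin_cases i <;> simp [Matrix.mulVec, dotProduct, Fin.sum_univ_three]
    refine ⟨_, hM, ?_, fun v hv hvU => ?_⟩
    · convert hmem using 1
      refine (Projectivization.mk_eq_mk_iff' _ _ _ _ _).2 ⟨1, ?_⟩
      rw [hmul]
      ext i; fin_cases i <;> simp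
    · have hr := hU _ _ hvU
      rw [hmul] at hr
      obtain ⟨δ, hδ'⟩ : ∃ δ, δ = ε⁻¹ := ⟨_, rfl⟩
      have e1 : ∀ x s : K, s * (ε * x) * ε⁻¹ = s * x := fun x s => by field_simp
      have e2 : -ε * v 0 + ε * y * v 1 + ε * m * v 2 = ε * (-v 0 + y * v 1 + m * v 2) := by ring
      rw [e2] at hr
      simp only [Matrix.cons_val, e1] at hr hr₀
      rw [← hδ'] at hr hr₀ hm ⊢
      rw [hm] at hr
      simp only [map_add, map_mul, map_neg, map_sub, map_one, hσ] at hr hr₀ ⊢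
      linear_combination hr - v 1 * σ (v 1) * hr₀

/-- An affine hermitian unital over a subfield, completed by the point at infinity. -/
lemma exists_eq_setOf_mk_mulVec {σ : K →+* K} (hσ : ∀ x, σ (σ x) = x)
    {M : Matrix (Fin 3) (Fin 3) K} (hM : IsUnit M) {E : Subfield K} (hE : ∀ x ∈ E, σ x ∈ E)
    {θ z₀ η₀ w l m : K} (hθE : θ ∈ E) (hθ : σ θ ≠ θ) (hw : w ≠ 0) (hl : l ≠ 0)
    {D : Set (K × K)}
    (hD : ∀ z η, (z₀ + w * z, η₀ + l * η + m * z) ∈ D ↔ z ∈ E ∧ η - θ * (z * σ z) ∈ E ∧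
      σ (η - θ * (z * σ z)) = η - θ * (z * σ z)) :
    ∃ g : Matrix (Fin 3) (Fin 3) K, IsUnit g ∧
      insert (infinitePoint hM) (affinePoint hM '' D) =
        {P | ∃ v : Fin 3 → K, (∀ i, v i ∈ E) ∧ v ≠ 0 ∧
          (∃ f ∈ E, σ f = f ∧ σ (v 0) * v 1 + v 2 * σ (v 2) = θ⁻¹ * f) ∧
          ∃ hgv : g.mulVec v ≠ 0, P = Projectivization.mk K (g.mulVec v) hgv} := by
  have hθ0 : θ ≠ 0 := by rintro rfl; simp at hθ
  obtain ⟨A, hA⟩ : ∃ A : Matrix (Fin 3) (Fin 3) K, A = !![1, 0, 0; η₀, -(l * θ), m; z₀, 0, w] :=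
    ⟨_, rfl⟩
  have hAu : IsUnit A := by
    rw [hA, Matrix.isUnit_iff_isUnit_det]
    simp [Matrix.det_fin_three, hθ0, hw, hl]
  have hmul : ∀ v, A.mulVec v =
      ![v 0, η₀ * v 0 - l * θ * v 1 + m * v 2, z₀ * v 0 + w * v 2] := fun v => by
    rw [hA]
    ext i
    fin_cases i <;> simp [Matrix.mulVec, dotProduct, Fin.sum_univ_three]; ring
  have hMA : ∀ v, (M * A).mulVec v = M.mulVec (A.mulVec v) := fun v =>
    (Matrix.mulVec_mulVec v M A).symm
  refine ⟨M * A, hM.mul hAu, ?_⟩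
  ext P
  constructor
  · rintro (rfl | ⟨⟨a, b⟩, hab, rfl⟩)
    · have h10 : (![0, 1, 0] : Fin 3 → K) ≠ 0 := fun h => one_ne_zero (congrFun h 1)
      refine ⟨![0, 1, 0], fun i => ?_, h10, ⟨0, E.zero_mem, by simp, by simp⟩,
        ne_zero_mulVec (hM.mul hAu) h10, ?_⟩
      · fin_cases i <;> simp [E.zero_mem, E.one_mem]
      · have := ne_zero_mulVec hM (ne_zero_mulVec hAu h10)
        simp only [hMA]
        exact (mk_mulVec_eq_infinitePoint hM (by simp [hmul]) (by simp [hmul]) this).symm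
    · obtain ⟨z, hz⟩ : ∃ z, z = (a - z₀) / w := ⟨_, rfl⟩
      obtain ⟨η, hη⟩ : ∃ η, η = (b - η₀ - m * z) / l := ⟨_, rfl⟩
      have ha : a = z₀ + w * z := by rw [hz]; field_simp; ring
      have hb : b = η₀ + l * η + m * z := by rw [hη]; field_simp; ring
      subst ha hb
      obtain ⟨hzE, hE', hfix⟩ := (hD z η).1 hab
      have hηE : η ∈ E := by
        have := E.add_mem hE' (E.mul_mem hθE (E.mul_mem hzE (hE z hzE)))
        rwa [sub_add_cancel] at this
      have h1 : (![1, -η / θ, z] : Fin 3 → K) ≠ 0 := fun h => one_ne_zero (congrFun h 0)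
      refine ⟨![1, -η / θ, z], fun i => ?_, h1, ⟨-(η - θ * (z * σ z)), E.neg_mem hE', ?_, ?_⟩,
        ne_zero_mulVec (hM.mul hAu) h1, ?_⟩
      · fin_cases i
        exacts [E.one_mem, E.div_mem (E.neg_mem hηE) hθE, hzE]
      · rw [map_neg, hfix]
      · simp
        field_simp
        ring
      · have := ne_zero_mulVec hM (ne_zero_mulVec hAu h1)
        simp only [hMA]
        rw [mk_mulVec_eq_affinePoint hM (by simp [hmul]) this]
        congr 1
        simp only [hmul, Matrix.cons_val]
        refine Prod.ext ?_ ?_ <;> simp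
        field_simp
        ring
  · rintro ⟨v, hvE, hv, ⟨f, hfE, hf, hform⟩, hgv, rfl⟩
    simp only [hMA] at hgv ⊢
    have hform' : θ * (σ (v 0) * v 1 + v 2 * σ (v 2)) = f := by rw [hform]; field_simp
    by_cases h0 : v 0 = 0
    · have h2 : v 2 = 0 := by
        by_contra h2
        have h2' : σ (v 2) ≠ 0 := (map_ne_zero σ).2 h2
        rw [← hform'] at hf
        simp only [h0, map_mul, map_zero, zero_mul, zero_add, hσ] at hf
        exact hθ (mul_right_cancel₀ (mul_ne_zero h2 h2') (by linear_combination hf))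
      exact .inl (mk_mulVec_eq_infinitePoint hM (by simp [hmul, h0]) (by simp [hmul, h0, h2]) hgv)
    · refine .inr ?_
      have h0' : σ (v 0) ≠ 0 := (map_ne_zero σ).2 h0
      rw [mk_mulVec_eq_affinePoint hM (by simpa [hmul] using h0) hgv]
      refine ⟨_, ?_, rfl⟩
      have e : -(θ * (v 1 / v 0)) - θ * (v 2 / v 0 * σ (v 2 / v 0)) = -(f / (v 0 * σ (v 0))) := by
        rw [← hform', map_div₀]
        field_simp
        ring
      have key := (hD (v 2 / v 0) (-(θ * (v 1 / v 0)))).2 (by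
        rw [e]
        refine ⟨E.div_mem (hvE 2) (hvE 0),
          E.neg_mem (E.div_mem hfE (E.mul_mem (hvE 0) (hE _ (hvE 0)))), ?_⟩
        rw [map_neg, map_div₀, map_mul, hσ, hf, mul_comm (v 0)])
      convert key using 2
      · simp [hmul]; field_simp
      · simp [hmul]; field_simp; ring

end Projective

/-- A finite field of order `r` containing a field of order `q`, both fixed by a common
involution of a larger field, has order an odd power of `q`. -/
lemma exists_odd_eq_pow {K : Type*} [Field K] [Finite K] {E R : Subfield K} {q r : ℕ}
    (hE : Nat.card E = q ^ 2) (hER : Nat.card ↥(E ⊓ R) = q) (hR : Nat.card R = r)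
    {θ : K} (hθE : θ ∈ E) (hθR : θ ∉ R) : ∃ e, Odd e ∧ r = q ^ e := by
  let _ : Algebra ↥(E ⊓ R) R := (Subfield.inclusion inf_le_right).toAlgebra
  have hcard := Module.natCard_eq_pow_finrank (K := ↥(E ⊓ R)) (V := R)
  rw [hER, hR] at hcard
  refine ⟨_, ?_, hcard⟩
  by_contra h
  obtain ⟨k, hk⟩ := Nat.not_odd_iff_even.1 h
  rw [hk, ← two_mul, pow_mul] at hcard
  refine hθR ((mem_subfield_iff_pow_card_eq R θ).2 ?_)
  rw [hR, hcard, ← hE]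
  clear * - hθE
  induction k with
  | zero => simp
  | succ k ih => rw [pow_succ, pow_mul, ih, ← mem_subfield_iff_pow_card_eq]; exact hθE

/-- A unital of order `q` embedded in the hermitian unital `H(GF(r²)|GF(r))` is
hermitian, `r` is an odd power of `q`, and the embedding is standard. -/
theorem subunital_of_finite_hermitian_unital
    {K : Type*} [Field K] (r : ℕ) (hr : IsPrimePow r)
    (hK : Nat.card K = r ^ 2)
    (R : Subfield K) (hR : Nat.card R = r)
    (ε : K) (hε : ε ∉ R)
    (q : ℕ) (hq : 2 ≤ q)
    (U : Set (Projectivization K (Fin 3 → K)))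
    (hUsub : U ⊆ hermSetPow R r ε)
    (hUcard : U.ncard = q ^ 3 + 1)
    (hUblocks : ∀ B, IsHermBlockPow R r ε B → (B ∩ U).Nontrivial → (B ∩ U).ncard = q + 1) :
    IsPrimePow q ∧ (∃ e : ℕ, Odd e ∧ r = q ^ e) ∧
    ∃ (E : Subfield K) (ε' : K) (g : Matrix (Fin 3) (Fin 3) K),
      Nat.card E = q ^ 2 ∧ Nat.card ↥(E ⊓ R) = q ∧
      ε' ∈ E ∧ ε' ∉ R ∧ IsUnit g ∧
      U = {P | ∃ v : Fin 3 → K, (∀ i, v i ∈ E) ∧ v ≠ 0 ∧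
            (∃ f ∈ E ⊓ R, v 0 ^ q * v 1 + v 2 ^ (q + 1) = ε' * f) ∧
            ∃ hgv : g.mulVec v ≠ 0, P = Projectivization.mk K (g.mulVec v) hgv} := by
  have hK0 : Nat.card K ≠ 0 := by rw [hK]; exact pow_ne_zero 2 hr.ne_zero
  have : Finite K := Nat.finite_of_card_ne_zero hK0
  have : Fintype R := Fintype.ofFinite R
  obtain ⟨σ, hσr⟩ : ∃ σ : K →+* K, ∀ x, σ x = x ^ r :=
    ⟨(FiniteField.frobeniusAlgHom R K).toRingHom, fun x => by
      simp [← hR, Nat.card_eq_fintype_card]⟩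
  have hσ : ∀ x, σ (σ x) = x := fun x => by
    have := Fintype.ofFinite K
    rw [hσr, hσr, ← pow_mul, ← sq, ← hK, Nat.card_eq_fintype_card, FiniteField.pow_card]
  have hmem : ∀ x, x ∈ R ↔ σ x = x := fun x => by
    rw [mem_subfield_iff_pow_card_eq, hR, hσr]
  have hσε : σ ε ≠ ε := fun h => hε ((hmem ε).2 h)
  have hε0 : ε ≠ 0 := by rintro rfl; simp at hσε
  have hδ : σ ε⁻¹ ≠ ε⁻¹ := by rw [map_inv₀]; simpa using hσε
  have hline : ∀ ℓ, IsLine K ℓ → (U ∩ ℓ).Nontrivial → (U ∩ ℓ).ncard = q + 1 := by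
    intro ℓ hℓ hnt
    have e : hermSetPow R r ε ∩ ℓ ∩ U = U ∩ ℓ := by
      rw [Set.inter_right_comm, Set.inter_eq_right.2 hUsub]
    rw [← e] at hnt ⊢
    exact hUblocks _ ⟨ℓ, hℓ, hnt.mono Set.inter_subset_left, rfl⟩ hnt
  have hform : ∀ v hv, Projectivization.mk K v hv ∈ U →
      σ (σ (v 0) * v 1 * ε⁻¹ + ε⁻¹ * (v 2 * σ (v 2))) =
        σ (v 0) * v 1 * ε⁻¹ + ε⁻¹ * (v 2 * σ (v 2)) := by
    intro v hv hvU
    obtain ⟨u, hu, hvu, f, hf, hfu⟩ := hUsub hvU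
    obtain ⟨k, rfl⟩ := (Projectivization.mk_eq_mk_iff' _ _ _ _ _).1 hvu
    rw [hmem] at hf
    rw [pow_succ, ← hσr, ← hσr] at hfu
    have e : σ ((k • u) 0) * (k • u) 1 * ε⁻¹ + ε⁻¹ * ((k • u) 2 * σ ((k • u) 2)) =
        k * σ k * f := by
      simp only [Pi.smul_apply, smul_eq_mul, map_mul]
      field_simp
      linear_combination k * σ k * hfu
    rw [e, map_mul, map_mul, hσ, hf, mul_comm k]
  have hne : U.Nonempty := Set.nonempty_of_ncard_ne_zero (by omega)
  obtain ⟨M, hM, hinf, hreal⟩ := exists_adapted_coordinates hσ hσε hne hform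
  obtain ⟨hU, hD⟩ := isAffineSubunital_of_projective hσ hδ hUcard hline hM hinf hreal
  obtain ⟨E, θ, z₀, η₀, w, l, m, hE, hEσ, hθE, hθ, hw, hl, hmemD⟩ :=
    hD.exists_coordinates hq hσ hδ
  have hER : Nat.card ↥(E ⊓ R) = q := by
    rw [← hEσ, ← Nat.card_coe_set_eq]
    exact Nat.card_congr (Equiv.subtypeEquivRight fun x => by simp [Subfield.mem_inf, hmem])
  have hθR : θ ∉ R := fun h => hθ ((hmem θ).1 h)
  obtain ⟨e, he, hre⟩ := exists_odd_eq_pow hE hER hR hθE hθR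
  have hpow : ∀ x ∈ E, σ x = x ^ q := by
    intro x hx
    rw [mem_subfield_iff_pow_card_eq, hE] at hx
    obtain ⟨k, rfl⟩ := he
    rw [hσr, hre, pow_succ, pow_mul, pow_mul]
    congr 1
    clear * - hx
    induction k with
    | zero => simp
    | succ k ih => rw [pow_succ, pow_mul, ih, hx]
  obtain ⟨g, hg, hgU⟩ := exists_eq_setOf_mk_mulVec hσ hM
    (fun x hx => by rw [hpow x hx]; exact E.pow_mem hx q) hθE hθ hw hl hmemD
  refine ⟨?_, ⟨e, he, hre⟩, E, θ⁻¹, g, hE, hER, E.inv_mem hθE, fun h => hθR ?_, hg, ?_⟩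
  · have := Fintype.ofFinite ↥(E ⊓ R)
    rw [← hER, Nat.card_eq_fintype_card]
    exact FiniteField.isPrimePow_card _
  · simpa using R.inv_mem h
  · rw [hU, hgU]
    ext P
    refine exists_congr fun v => and_congr_right fun hvE => and_congr_right fun _ =>
      and_congr_left fun _ => exists_congr fun f => ?_
    rw [Subfield.mem_inf, hmem, hpow _ (hvE 0), hpow _ (hvE 2), pow_succ', and_assoc]
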